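/- Let 𝒜 be a unital associative ℂ-algebra, let U : ℂ∖{0} → M₂(𝒜) satisfy the reflection equation, let α ∈ ℂ∖{0}, and let β ∈ ℂ∖{0} with β² ∉ {1, q², q⁴, q⁶, q⁸}. Then the gauged family ℬ₋ is pseudo-commutative: ℬ₋(λ₂|β)·ℬ₋(λ₁|β/q²) = ℬ₋(λ₁|β)·ℬ₋(λ₂|β/q²) for all λ₁, λ₂ ∈ ℂ∖{0} such that (λ₁/λ₂)² ∉ {1, q², q^{−2}} and (λ₁λ₂)² ∉ {1, q², q^{−2}, q⁴}. -/

import Mathlib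

/-- The 6-vertex `R`-matrix `R(x)` acting on `ℂ² ⊗ ℂ²` (basis indexed by
`Fin 2 × Fin 2`). -/
noncomputable def Rmat (q x : ℂ) : Matrix (Fin 2 × Fin 2) (Fin 2 × Fin 2) ℂ :=
  Matrix.of fun i j : Fin 2 × Fin 2 =>
    if i = j then (if i.1 = i.2 then q * x - (q * x)⁻¹ else x - x⁻¹)
    else if i.1 = j.2 ∧ i.2 = j.1 ∧ i.1 ≠ i.2 then q - q⁻¹
    else 0

/-- `W₁ = W ⊗ I₂` as a `4×4` matrix over `A`. -/
noncomputable def kron1 {A : Type*} [Ring A] (W : Matrix (Fin 2) (Fin 2) A) :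
    Matrix (Fin 2 × Fin 2) (Fin 2 × Fin 2) A :=
  Matrix.kroneckerMap (· * ·) W (1 : Matrix (Fin 2) (Fin 2) A)

/-- `W₂ = I₂ ⊗ W` as a `4×4` matrix over `A`. -/
noncomputable def kron2 {A : Type*} [Ring A] (W : Matrix (Fin 2) (Fin 2) A) :
    Matrix (Fin 2 × Fin 2) (Fin 2 × Fin 2) A :=
  Matrix.kroneckerMap (· * ·) (1 : Matrix (Fin 2) (Fin 2) A) W

/-- `U : ℂ∖{0} → M₂(𝒜)` satisfies the reflection equation
`R(λ/μ) U₁(λ) R(λμ/q) U₂(μ) = U₂(μ) R(λμ/q) U₁(λ) R(λ/μ)`. -/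
def ReflEq (q : ℂ) {A : Type*} [Ring A] [Algebra ℂ A]
    (U : ℂ → Matrix (Fin 2) (Fin 2) A) : Prop :=
  ∀ lam mu : ℂ, lam ≠ 0 → mu ≠ 0 →
    (Rmat q (lam / mu)).map (algebraMap ℂ A) * kron1 (U lam) *
        (Rmat q (lam * mu / q)).map (algebraMap ℂ A) * kron2 (U mu) =
      kron2 (U mu) * (Rmat q (lam * mu / q)).map (algebraMap ℂ A) * kron1 (U lam) *
        (Rmat q (lam / mu)).map (algebraMap ℂ A)

/-- The boundary `K`-matrix `K(λ; ζ, κ, t)`. -/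
noncomputable def Kmat (q sq z k t : ℂ) (lam : ℂ) : Matrix (Fin 2) (Fin 2) ℂ :=
  (z - z⁻¹)⁻¹ •
    !![lam * z / sq - sq / (lam * z), k * Complex.exp t * (lam ^ 2 / q - q / lam ^ 2);
       k * Complex.exp (-t) * (lam ^ 2 / q - q / lam ^ 2), sq * z / lam - lam / (z * sq)]

/-- The set `{1, q^{±1}, q^{±2}, q^{±3}, q^{±4}}` of excluded values. -/
noncomputable def excl (q : ℂ) : Set ℂ :=
  {1, q, q⁻¹, q ^ 2, (q ^ 2)⁻¹, q ^ 3, (q ^ 3)⁻¹, q ^ 4, (q ^ 4)⁻¹}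

/-- The gauged generator `𝒜₋(λ|β)` (with fixed gauge parameter `α`). -/
noncomputable def gA {A : Type*} [Ring A] [Algebra ℂ A] (q sq al be : ℂ)
    (U : ℂ → Matrix (Fin 2) (Fin 2) A) (lam : ℂ) : A :=
  (be / q ^ 2 - q ^ 2 / be)⁻¹ •
    ((-(lam * q * sq / be)) • U lam 0 0 + (-(al * q)) • U lam 0 1 +
      (al * q)⁻¹ • U lam 1 0 + (be / (lam * q * sq)) • U lam 1 1)

/-- The gauged generator `ℬ₋(λ|β)` (with fixed gauge parameter `α`). -/
noncomputable def gB {A : Type*} [Ring A] [Algebra ℂ A] (q sq al be : ℂ)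
    (U : ℂ → Matrix (Fin 2) (Fin 2) A) (lam : ℂ) : A :=
  (be - be⁻¹)⁻¹ •
    ((-(lam * be / sq)) • U lam 0 0 + (-(al * q)) • U lam 0 1 +
      (be ^ 2 / (al * q)) • U lam 1 0 + (be * sq / lam) • U lam 1 1)

/-- The gauged generator `𝒞₋(λ|β)` (with fixed gauge parameter `α`). -/
noncomputable def gC {A : Type*} [Ring A] [Algebra ℂ A] (q sq al be : ℂ)
    (U : ℂ → Matrix (Fin 2) (Fin 2) A) (lam : ℂ) : A :=
  (be / q ^ 2 - q ^ 2 / be)⁻¹ •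
    ((lam * q * sq / be) • U lam 0 0 + (al * q) • U lam 0 1 +
      (-(q ^ 3 / (al * be ^ 2))) • U lam 1 0 + (-(q ^ 2 * sq / (lam * be))) • U lam 1 1)

/-- The gauged generator `𝒟₋(λ|β)` (with fixed gauge parameter `α`). -/
noncomputable def gD {A : Type*} [Ring A] [Algebra ℂ A] (q sq al be : ℂ)
    (U : ℂ → Matrix (Fin 2) (Fin 2) A) (lam : ℂ) : A :=
  (be - be⁻¹)⁻¹ •
    ((lam * be / sq) • U lam 0 0 + (al * q) • U lam 0 1 +
      (-(al * q)⁻¹) • U lam 1 0 + (-(sq / (lam * be))) • U lam 1 1)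

set_option linter.unusedSimpArgs false in
set_option maxHeartbeats 4000000 in
lemma aux (q sq al be lam1 lam2 : ℂ) (hq0 : q ≠ 0) (hs0 : sq ≠ 0) (hsq : q = sq ^ 2) (hal : al ≠ 0)
    (hbe : be ≠ 0) (h1 : lam1 ≠ 0) (h2 : lam2 ≠ 0)
    {A : Type*} [Ring A] [Algebra ℂ A] (u v : Matrix (Fin 2) (Fin 2) A)
    (h : (Rmat q (lam1 / lam2)).map (algebraMap ℂ A) * kron1 u *
        (Rmat q (lam1 * lam2 / q)).map (algebraMap ℂ A) * kron2 v =
      kron2 v * (Rmat q (lam1 * lam2 / q)).map (algebraMap ℂ A) * kron1 u *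
        (Rmat q (lam1 / lam2)).map (algebraMap ℂ A)) :
    ((q*lam1/lam2 - lam2/(q*lam1)) * (lam1*lam2/q-q/(lam1*lam2))) •
     (((-(lam2 * be / sq)) • v 0 0 + (-(al * q)) • v 0 1 +
      (be ^ 2 / (al * q)) • v 1 0 + (be * sq / lam2) • v 1 1) *
      ((-(lam1 * (be/q^2) / sq)) • u 0 0 + (-(al * q)) • u 0 1 +
      ((be/q^2) ^ 2 / (al * q)) • u 1 0 + ((be/q^2) * sq / lam1) • u 1 1)) =
    ((q*lam1/lam2 - lam2/(q*lam1)) * (lam1*lam2/q-q/(lam1*lam2))) •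
     (((-(lam1 * be / sq)) • u 0 0 + (-(al * q)) • u 0 1 +
      (be ^ 2 / (al * q)) • u 1 0 + (be * sq / lam1) • u 1 1) *
      ((-(lam2 * (be/q^2) / sq)) • v 0 0 + (-(al * q)) • v 0 1 +
      ((be/q^2) ^ 2 / (al * q)) • v 1 0 + ((be/q^2) * sq / lam2) • v 1 1)) := by
  have comm : ∀ (c : ℂ) (x : A), x * algebraMap ℂ A c = c • x := fun c x => by
    rw [Algebra.smul_def, Algebra.commutes]
  have h0000 := congrFun (congrFun h (0,0)) (0,0)
  have h0001 := congrFun (congrFun h (0,0)) (0,1)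
  have h0010 := congrFun (congrFun h (0,0)) (1,0)
  have h0011 := congrFun (congrFun h (0,0)) (1,1)
  have h0100 := congrFun (congrFun h (0,1)) (0,0)
  have h0101 := congrFun (congrFun h (0,1)) (0,1)
  have h0110 := congrFun (congrFun h (0,1)) (1,0)
  have h0111 := congrFun (congrFun h (0,1)) (1,1)
  have h1000 := congrFun (congrFun h (1,0)) (0,0)
  have h1001 := congrFun (congrFun h (1,0)) (0,1)
  have h1010 := congrFun (congrFun h (1,0)) (1,0)
  have h1011 := congrFun (congrFun h (1,0)) (1,1)
  have h1100 := congrFun (congrFun h (1,1)) (0,0)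
  have h1101 := congrFun (congrFun h (1,1)) (0,1)
  have h1110 := congrFun (congrFun h (1,1)) (1,0)
  have h1111 := congrFun (congrFun h (1,1)) (1,1)
  clear h
  simp only [Matrix.mul_apply, Fintype.sum_prod_type, Fin.sum_univ_two, kron1, kron2, Rmat,
    Matrix.map_apply, Matrix.kroneckerMap_apply, Matrix.of_apply, Matrix.one_apply, Prod.mk.injEq,
    Fin.isValue, zero_ne_one, one_ne_zero, and_true, and_false, true_and, false_and, and_self,
    if_true, if_false, ne_eq, not_true_eq_false, not_false_eq_true, map_zero, mul_zero, zero_mul,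
    mul_one, one_mul, add_zero, zero_add, ↓reduceIte, comm, ← Algebra.smul_def, zero_smul, smul_zero,
    add_mul, mul_add, smul_add, smul_mul_assoc, mul_smul_comm, smul_smul]
    at h0000 h0001 h0010 h0011 h0100 h0101 h0110 h0111 h1000 h1001 h1010 h1011 h1100 h1101 h1110 h1111 ⊢
  generalize u 0 0 = u00, u 0 1 = u01, u 1 0 = u10, u 1 1 = u11,
    v 0 0 = v00, v 0 1 = v01, v 1 0 = v10, v 1 1 = v11 at *
  linear_combination (norm := skip) (-(lam1*lam2*be^2/(q*q^3))) • ((1*1) • h0000 + (1*(al*q*q^2*sq/(be*lam2))) • h0001 + (1*(al*q*q*sq/(be*lam1))) • h0010 + (1*(al^2*q^2*q^3*sq^2/(be^2*lam1*lam2))) • h0011 + ((-(be*sq/(al*q*lam2)))*1) • h0100 + ((-(be*sq/(al*q*lam2)))*(al*q*q^2*sq/(be*lam2))) • h0101 + ((-(be*sq/(al*q*lam2)))*(al*q*q*sq/(be*lam1))) • h0110 + ((-(be*sq/(al*q*lam2)))*(al^2*q^2*q^3*sq^2/(be^2*lam1*lam2))) • h0111 + ((-(be*sq/(al*q^2*lam1)))*1)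 • h1000 + ((-(be*sq/(al*q^2*lam1)))*(al*q*q^2*sq/(be*lam2))) • h1001 + ((-(be*sq/(al*q^2*lam1)))*(al*q*q*sq/(be*lam1))) • h1010 + ((-(be*sq/(al*q^2*lam1)))*(al^2*q^2*q^3*sq^2/(be^2*lam1*lam2))) • h1011 + ((be^2*sq^2/(al^2*q^3*lam1*lam2))*1) • h1100 + ((be^2*sq^2/(al^2*q^3*lam1*lam2))*(al*q*q^2*sq/(be*lam2))) • h1101 + ((be^2*sq^2/(al^2*q^3*lam1*lam2))*(al*q*q*sq/(be*lam1))) • h1110 + ((be^2*sq^2/(al^2*q^3*lam1*lam2))*(al^2*q^2*q^3*sq^2/(be^2*lam1*lam2))) • h1111)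
  subst hsq
  match_scalars <;> field_simp <;> ring

/-- Pseudo-commutativity of the gauged family `ℬ₋`:
`ℬ₋(λ₂|β) ℬ₋(λ₁|β/q²) = ℬ₋(λ₁|β) ℬ₋(λ₂|β/q²)`. -/
theorem stmt_13 (q sq : ℂ) (hq0 : q ≠ 0) (hsq : sq ^ 2 = q)
    (hqroot : ∀ n : ℕ, 1 ≤ n → n ≤ 8 → q ^ n ≠ 1)
    {A : Type*} [Ring A] [Algebra ℂ A]
    (U : ℂ → Matrix (Fin 2) (Fin 2) A) (hU : ReflEq q U)
    (al : ℂ) (hal : al ≠ 0) (be : ℂ) (hbe : be ≠ 0)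
    (hbe2 : be ^ 2 ∉ ({1, q ^ 2, q ^ 4, q ^ 6, q ^ 8} : Set ℂ)) :
    ∀ lam1 lam2 : ℂ, lam1 ≠ 0 → lam2 ≠ 0 →
      (lam1 / lam2) ^ 2 ∉ ({1, q ^ 2, (q ^ 2)⁻¹} : Set ℂ) →
      (lam1 * lam2) ^ 2 ∉ ({1, q ^ 2, (q ^ 2)⁻¹, q ^ 4} : Set ℂ) →
      gB q sq al be U lam2 * gB q sq al (be / q ^ 2) U lam1 =
        gB q sq al be U lam1 * gB q sq al (be / q ^ 2) U lam2 := by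
  intro lam1 lam2 h1 h2 h3 h4
  have hs0 : sq ≠ 0 := by
    rintro rfl
    exact hq0 (by rw [← hsq]; simp)
  have key := aux q sq al be lam1 lam2 hq0 hs0 hsq.symm hal hbe h1 h2 (U lam1) (U lam2)
    (hU lam1 lam2 h1 h2)
  simp only [Set.mem_insert_iff, Set.mem_singleton_iff, not_or] at h3 h4
  have n1 : q*lam1/lam2 - lam2/(q*lam1) ≠ 0 := by
    intro h
    apply h3.2.2
    field_simp at h ⊢
    linear_combination h
  have n2 : lam1*lam2/q-q/(lam1*lam2) ≠ 0 := by
    intro h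
    apply h4.2.1
    field_simp at h ⊢
    linear_combination h
  have key2 := smul_right_injective A (mul_ne_zero n1 n2) key
  unfold gB
  simp only [smul_mul_assoc, mul_smul_comm] at key2 ⊢
  rw [key2]
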